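/- Let Δ ⊂ ℝ^d be a lattice simplex of dimension d with normalized volume Vol(Δ) = 2 which is not a lattice pyramid. Then d is odd, say d = 2k − 1 with k ≥ 1, the δ-polynomial of Δ equals 1 + t^k, and Δ is unimodularly equivalent to Δ^(2) = conv{0, e_1, …, e_{d−1}, e_1 + ⋯ + e_{d−1} + 2e_d} ⊂ ℝ^d. -/

import Mathlib

open Pointwise Polynomial

noncomputable section

/-- The set of lattice points of `ℝ^d` (points with integer coordinates). -/
def latticePts (d : ℕ) : Set (Fin d → ℝ) := {x | ∀ i, ∃ z : ℤ, x i = (z : ℝ)}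

/-- A lattice polytope: the convex hull of finitely many lattice points. -/
def IsLatticePolytope {d : ℕ} (P : Set (Fin d → ℝ)) : Prop :=
  ∃ V : Finset (Fin d → ℝ), (V : Set (Fin d → ℝ)) ⊆ latticePts d ∧
    P = convexHull ℝ (V : Set (Fin d → ℝ))

/-- `|nP ∩ ℤ^d|`. -/
def ehrhartCount {d : ℕ} (P : Set (Fin d → ℝ)) (n : ℕ) : ℕ :=
  (latticePts d ∩ (n : ℝ) • P).ncard

/-- The Ehrhart series `1 + Σ_{n ≥ 1} |nP ∩ ℤ^d| tⁿ`. -/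
def ehrhartSeries {d : ℕ} (P : Set (Fin d → ℝ)) : PowerSeries ℤ :=
  PowerSeries.mk fun n => if n = 0 then 1 else (ehrhartCount P n : ℤ)

/-- `p` is the δ-polynomial of the lattice polytope `P ⊆ ℝ^d` of dimension `d`,
i.e. `(1 - t)^(d+1) (1 + Σ_{n ≥ 1} |nP ∩ ℤ^d| tⁿ) = p`. -/
def HasDeltaPoly {d : ℕ} (P : Set (Fin d → ℝ)) (p : Polynomial ℤ) : Prop :=
  (1 - PowerSeries.X) ^ (d + 1) * ehrhartSeries P = (p : PowerSeries ℤ)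

/-- Unimodular equivalence: an affine map carrying `ℤ^d ∩ aff P` bijectively onto
`ℤ^e ∩ aff Q` and mapping `P` onto `Q`. -/
def UnimodEquiv {d e : ℕ} (P : Set (Fin d → ℝ)) (Q : Set (Fin e → ℝ)) : Prop :=
  ∃ f : (Fin d → ℝ) →ᵃ[ℝ] (Fin e → ℝ),
    Set.BijOn f (latticePts d ∩ (affineSpan ℝ P : Set (Fin d → ℝ)))
      (latticePts e ∩ (affineSpan ℝ Q : Set (Fin e → ℝ))) ∧ f '' P = Q

/-- The lattice pyramid `Pyr(Q) = conv(Q × {0}, (0,…,0,1)) ⊆ ℝ^{e+1}`. -/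
def pyramidOver {e : ℕ} (Q : Set (Fin e → ℝ)) : Set (Fin (e + 1) → ℝ) :=
  convexHull ℝ
    ((fun x : Fin e → ℝ => Fin.snoc x (0 : ℝ)) '' Q ∪ {Fin.snoc (0 : Fin e → ℝ) (1 : ℝ)})

/-- `P` is a lattice pyramid over some (full-dimensional) lattice polytope. -/
def IsLatticePyramid {d : ℕ} (P : Set (Fin d → ℝ)) : Prop :=
  ∃ (e : ℕ) (Q : Set (Fin e → ℝ)), IsLatticePolytope Q ∧ affineSpan ℝ Q = ⊤ ∧
    UnimodEquiv P (pyramidOver Q)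

/-- `P ⊆ ℝ^d` is a simplex (of some dimension). -/
def IsSimplex {d : ℕ} (P : Set (Fin d → ℝ)) : Prop :=
  ∃ (n : ℕ) (v : Fin (n + 1) → Fin d → ℝ), AffineIndependent ℝ v ∧
    P = convexHull ℝ (Set.range v)

/-- A full-dimensional lattice simplex of dimension `d` in `ℝ^d`. -/
def IsLatticeSimplexFD {d : ℕ} (Δ : Set (Fin d → ℝ)) : Prop :=
  ∃ v : Fin (d + 1) → Fin d → ℝ, AffineIndependent ℝ v ∧
    (∀ i, v i ∈ latticePts d) ∧ Δ = convexHull ℝ (Set.range v)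

/-- `ℤ((P,1) ∩ ℤ^{d+1}) = ℤ^{d+1}`: the lattice points of `P`, with last coordinate `1`
appended, generate all of `ℤ^{d+1}` as a group. -/
def SpansLattice {d : ℕ} (P : Set (Fin d → ℝ)) : Prop :=
  AddSubgroup.closure {y : Fin (d + 1) → ℤ |
    y (Fin.last d) = 1 ∧ (fun i : Fin d => (y i.castSucc : ℝ)) ∈ P} = ⊤

/-- The finite abelian group `Λ_Δ ⊆ (ℝ/ℤ)^{d+1}` attached to a lattice simplex with
ordered vertices `v 0, …, v d`, encoded by its canonical representatives in `[0,1)`. -/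
def simplexLambda {d : ℕ} (v : Fin (d + 1) → Fin d → ℝ) : Set (Fin (d + 1) → ℝ) :=
  {c | (∀ i, 0 ≤ c i ∧ c i < 1) ∧
    (∀ j : Fin d, ∃ z : ℤ, (∑ i, c i * v i j) = (z : ℝ)) ∧
    (∃ z : ℤ, (∑ i, c i) = (z : ℝ))}

/-- The standard basis vector `e_j` of `ℝ^d` (0-indexed). -/
def stdE (d : ℕ) (j : Fin d) : Fin d → ℝ := fun i => if i = j then 1 else 0

/-- The simplex `Δ⁽²⁾ = conv{0, e₁, …, e_{d−1}, e₁ + ⋯ + e_{d−1} + 2e_d} ⊆ ℝ^d`. -/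
def deltaTwoSimplex (d : ℕ) : Set (Fin d → ℝ) :=
  convexHull ℝ
    ({0, fun i : Fin d => if (i : ℕ) = d - 1 then (2 : ℝ) else 1} ∪
      {x | ∃ j : Fin d, (j : ℕ) < d - 1 ∧ x = stdE d j})

/-- The lattice `ℤ^d` as an additive subgroup of `ℝ^d`. -/
def latticeSubgroup (d : ℕ) : AddSubgroup (Fin d → ℝ) where
  carrier := latticePts d
  zero_mem' := fun _ => ⟨0, by simp⟩
  add_mem' := by
    intro a b ha hb i
    obtain ⟨m, hm⟩ := ha i
    obtain ⟨n, hn⟩ := hb i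
    exact ⟨m + n, by simp [hm, hn]⟩
  neg_mem' := by
    intro a ha i
    obtain ⟨m, hm⟩ := ha i
    exact ⟨-m, by simp [hm]⟩

lemma mem_latticeSubgroup {d : ℕ} {x : Fin d → ℝ} : x ∈ latticeSubgroup d ↔ x ∈ latticePts d :=
  Iff.rfl

lemma linearCombination_intCast_mem {d : ℕ} {ι : Type*} [Fintype ι] {v : ι → Fin d → ℝ}
    (hv : ∀ i, v i ∈ latticePts d) (z : ι → ℤ) :
    Fintype.linearCombination ℝ v (fun i => (z i : ℝ)) ∈ latticeSubgroup d := by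
  rw [Fintype.linearCombination_apply]
  refine sum_mem fun i _ => ?_
  rw [Int.cast_smul_eq_zsmul]
  exact zsmul_mem (mem_latticeSubgroup.2 (hv i)) _

lemma AffineIndependent.eq_of_linearCombination_eq {ι E : Type*} [Fintype ι] [AddCommGroup E]
    [Module ℝ E] {v : ι → E} (hv : AffineIndependent ℝ v) {a b : ι → ℝ}
    (hs : ∑ i, a i = ∑ i, b i)
    (h : Fintype.linearCombination ℝ v a = Fintype.linearCombination ℝ v b) : a = b := by
  have h0 := hv.eq_zero_of_sum_eq_zero (s := Finset.univ) (w := a - b)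
    (by simp [hs]) (by
      have : Fintype.linearCombination ℝ v (a - b) = 0 := by rw [map_sub, h, sub_self]
      rwa [Fintype.linearCombination_apply] at this)
  funext i
  exact sub_eq_zero.1 (h0 i (Finset.mem_univ i))

lemma AffineIndependent.affineSpan_range_eq_top {d : ℕ} {v : Fin (d + 1) → Fin d → ℝ}
    (hv : AffineIndependent ℝ v) : affineSpan ℝ (Set.range v) = ⊤ := by
  rw [hv.affineSpan_eq_top_iff_card_eq_finrank_add_one]
  simp

lemma AffineIndependent.exists_linearCombination_eq {d : ℕ} {v : Fin (d + 1) → Fin d → ℝ}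
    (hv : AffineIndependent ℝ v) (x : Fin d → ℝ) :
    ∃ c : Fin (d + 1) → ℝ, ∑ i, c i = 1 ∧ Fintype.linearCombination ℝ v c = x :=
  let b : AffineBasis (Fin (d + 1)) ℝ (Fin d → ℝ) := ⟨v, hv, hv.affineSpan_range_eq_top⟩
  ⟨fun i => b.coord i x, b.sum_coord_apply_eq_one x, by
    rw [Fintype.linearCombination_apply]
    exact b.linear_combination_coord_eq_self x⟩

lemma AffineMap.apply_linearCombination {ι E F : Type*} [Fintype ι] [AddCommGroup E] [Module ℝ E]
    [AddCommGroup F] [Module ℝ F] (f : E →ᵃ[ℝ] F) (v : ι → E) {c : ι → ℝ} (hc : ∑ i, c i = 1) :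
    f (Fintype.linearCombination ℝ v c) = Fintype.linearCombination ℝ (f ∘ v) c := by
  simp only [Fintype.linearCombination_apply]
  rw [← Finset.univ.affineCombination_eq_linear_combination v c hc,
    Finset.map_affineCombination _ _ _ hc,
    Finset.univ.affineCombination_eq_linear_combination _ c hc]

/-- An affine basis of `ℝ^d` can be mapped to any family of points. -/
lemma AffineIndependent.exists_affineMap {d : ℕ} {v : Fin (d + 1) → Fin d → ℝ}
    (hv : AffineIndependent ℝ v) {F : Type*} [AddCommGroup F] [Module ℝ F]
    (w : Fin (d + 1) → F) : ∃ f : (Fin d → ℝ) →ᵃ[ℝ] F, f ∘ v = w := by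
  let b : AffineBasis (Fin (d + 1)) ℝ (Fin d → ℝ) := ⟨v, hv, hv.affineSpan_range_eq_top⟩
  let f : (Fin d → ℝ) →ᵃ[ℝ] F :=
    ∑ i, (LinearMap.toSpanSingleton ℝ F (w i)).toAffineMap.comp (b.coord i)
  have hf : ∀ x, f x = ∑ i, b.coord i x • w i := by
    intro x
    have : ∀ s : Finset (Fin (d + 1)),
        (∑ i ∈ s, (LinearMap.toSpanSingleton ℝ F (w i)).toAffineMap.comp (b.coord i)) x
          = ∑ i ∈ s, b.coord i x • w i := by
      intro s
      induction s using Finset.induction_on with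
      | empty => simp
      | insert a s ha ih => rw [Finset.sum_insert ha, Finset.sum_insert ha, ← ih]; simp
    exact this _
  refine ⟨f, funext fun j => ?_⟩
  have hj : v j = b j := rfl
  simp [hf, hj, AffineBasis.coord_apply]

/-- Two full-dimensional simplices whose vertices have the same integral affine combinations
are unimodularly equivalent. -/
lemma unimodEquiv_of_mem_latticePts_iff {d : ℕ} {v w : Fin (d + 1) → Fin d → ℝ}
    (hv : AffineIndependent ℝ v) (hw : AffineIndependent ℝ w)
    (h : ∀ c : Fin (d + 1) → ℝ, ∑ i, c i = 1 →
      (Fintype.linearCombination ℝ v c ∈ latticePts d ↔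
        Fintype.linearCombination ℝ w c ∈ latticePts d)) :
    UnimodEquiv (convexHull ℝ (Set.range v)) (convexHull ℝ (Set.range w)) := by
  obtain ⟨f, hf⟩ := hv.exists_affineMap w
  refine ⟨f, ?_, by rw [AffineMap.image_convexHull, ← Set.range_comp, hf]⟩
  rw [affineSpan_convexHull, affineSpan_convexHull, hv.affineSpan_range_eq_top,
    hw.affineSpan_range_eq_top]
  simp only [AffineSubspace.top_coe, Set.inter_univ]
  refine ⟨fun x hx => ?_, fun x _ y _ hxy => ?_, fun y hy => ?_⟩
  · obtain ⟨c, hc, rfl⟩ := hv.exists_linearCombination_eq x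
    rw [f.apply_linearCombination v hc, hf]
    exact (h c hc).1 hx
  · obtain ⟨a, ha, rfl⟩ := hv.exists_linearCombination_eq x
    obtain ⟨b, hb, rfl⟩ := hv.exists_linearCombination_eq y
    rw [f.apply_linearCombination v ha, f.apply_linearCombination v hb, hf] at hxy
    rw [hw.eq_of_linearCombination_eq (ha.trans hb.symm) hxy]
  · obtain ⟨c, hc, rfl⟩ := hw.exists_linearCombination_eq y
    exact ⟨_, (h c hc).2 hy, by rw [f.apply_linearCombination v hc, hf]⟩

lemma sum_fract_eq_sub {ι : Type*} [Fintype ι] (c : ι → ℝ) :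
    ∑ i, Int.fract (c i) = ∑ i, c i - ((∑ i, ⌊c i⌋ : ℤ) : ℝ) := by
  simp only [← Int.self_sub_floor, Finset.sum_sub_distrib, Int.cast_sum]

lemma mem_simplexLambda_iff {d : ℕ} {v : Fin (d + 1) → Fin d → ℝ} {c : Fin (d + 1) → ℝ} :
    c ∈ simplexLambda v ↔ (∀ i, 0 ≤ c i ∧ c i < 1) ∧
      Fintype.linearCombination ℝ v c ∈ latticePts d ∧ ∃ z : ℤ, ∑ i, c i = (z : ℝ) := by
  simp [simplexLambda, latticePts, Fintype.linearCombination_apply]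

lemma fract_mem_simplexLambda {d : ℕ} {v : Fin (d + 1) → Fin d → ℝ}
    (hv : ∀ i, v i ∈ latticePts d) {c : Fin (d + 1) → ℝ}
    (hc : Fintype.linearCombination ℝ v c ∈ latticePts d) (hs : ∃ z : ℤ, ∑ i, c i = (z : ℝ)) :
    (fun i => Int.fract (c i)) ∈ simplexLambda v := by
  refine mem_simplexLambda_iff.2
    ⟨fun i => ⟨Int.fract_nonneg _, Int.fract_lt_one _⟩, ?_, ?_⟩
  · have : (fun i => Int.fract (c i)) = c - fun i => (⌊c i⌋ : ℝ) := rfl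
    rw [this, map_sub]
    exact sub_mem (mem_latticeSubgroup.2 hc) (linearCombination_intCast_mem hv _)
  · obtain ⟨z, hz⟩ := hs
    exact ⟨z - ∑ i, ⌊c i⌋, by rw [sum_fract_eq_sub, hz]; push_cast; ring⟩

/-- Only finitely many coefficient vectors in a bounded box represent lattice points. -/
lemma finite_setOf_linearCombination_mem {d : ℕ} {v : Fin (d + 1) → Fin d → ℝ}
    (hv : AffineIndependent ℝ v) (K : ℝ) :
    {c : Fin (d + 1) → ℝ | (∀ i, 0 ≤ c i ∧ c i ≤ K) ∧
      Fintype.linearCombination ℝ v c ∈ latticePts d ∧ ∃ z : ℤ, ∑ i, c i = (z : ℝ)}.Finite := by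
  let T : (Fin (d + 1) → ℝ) → (Fin d → ℝ) × ℝ :=
    fun c => (Fintype.linearCombination ℝ v c, ∑ i, c i)
  have hfin : ∀ B : ℝ, {x : ℝ | |x| ≤ B ∧ ∃ z : ℤ, x = z}.Finite := by
    intro B
    refine ((Set.finite_Icc (-⌈B⌉) ⌈B⌉).image (fun z : ℤ => (z : ℝ))).subset ?_
    rintro x ⟨hx, z, rfl⟩
    refine ⟨z, ?_, rfl⟩
    rw [abs_le] at hx
    have := Int.le_ceil B
    exact ⟨by exact_mod_cast (show (-(⌈B⌉ : ℝ)) ≤ z by linarith),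
      by exact_mod_cast (show (z : ℝ) ≤ ⌈B⌉ by linarith)⟩
  refine Set.Finite.of_finite_image (f := T) ?_ ?_
  · refine ((Set.Finite.pi' fun j : Fin d => hfin (∑ i, K * |v i j|)).prod
      (hfin (∑ _i : Fin (d + 1), K))).subset ?_
    rintro _ ⟨c, ⟨hc, hl, hs⟩, rfl⟩
    have habs : ∀ i, |c i| ≤ K := fun i => by rw [abs_of_nonneg (hc i).1]; exact (hc i).2
    refine ⟨fun j => ⟨?_, hl j⟩, ?_, hs⟩
    · simp only [T, Fintype.linearCombination_apply, Finset.sum_apply, Pi.smul_apply, smul_eq_mul]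
      refine (Finset.abs_sum_le_sum_abs _ _).trans (Finset.sum_le_sum fun i _ => ?_)
      rw [abs_mul]
      exact mul_le_mul_of_nonneg_right (habs i) (abs_nonneg _)
    · change |∑ i, c i| ≤ _
      exact (Finset.abs_sum_le_sum_abs c _).trans (Finset.sum_le_sum fun i _ => habs i)
  · intro a _ b _ hab
    exact hv.eq_of_linearCombination_eq (congrArg Prod.snd hab) (congrArg Prod.fst hab)

lemma finite_simplexLambda {d : ℕ} {v : Fin (d + 1) → Fin d → ℝ}
    (hv : AffineIndependent ℝ v) : (simplexLambda v).Finite :=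
  (finite_setOf_linearCombination_mem hv 1).subset fun c hc => by
    obtain ⟨h1, h2, h3⟩ := mem_simplexLambda_iff.1 hc
    exact ⟨fun i => ⟨(h1 i).1, (h1 i).2.le⟩, h2, h3⟩

/-- The nonnegative coefficient vectors of total weight `n` that represent lattice points. -/
def latticeWeights {d : ℕ} (v : Fin (d + 1) → Fin d → ℝ) (n : ℕ) : Set (Fin (d + 1) → ℝ) :=
  {c | (∀ i, 0 ≤ c i) ∧ ∑ i, c i = n ∧ Fintype.linearCombination ℝ v c ∈ latticePts d}

lemma finite_latticeWeights {d : ℕ} {v : Fin (d + 1) → Fin d → ℝ}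
    (hv : AffineIndependent ℝ v) (n : ℕ) : (latticeWeights v n).Finite :=
  (finite_setOf_linearCombination_mem hv n).subset fun c ⟨h0, hs, hl⟩ =>
    ⟨fun i => ⟨h0 i, hs ▸ Finset.single_le_sum (fun j _ => h0 j) (Finset.mem_univ i)⟩, hl,
      n, by simpa using hs⟩

lemma mem_convexHull_range_iff {ι E : Type*} [Fintype ι] [AddCommGroup E] [Module ℝ E]
    {v : ι → E} {x : E} : x ∈ convexHull ℝ (Set.range v) ↔
      ∃ c : ι → ℝ, (∀ i, 0 ≤ c i) ∧ ∑ i, c i = 1 ∧ Fintype.linearCombination ℝ v c = x := by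
  classical
  have : Set.range v = Fintype.linearCombination ℝ v '' Set.range fun i => Pi.single i (1 : ℝ) := by
    rw [← Set.range_comp]
    congr 1
    funext i
    simp [Fintype.linearCombination_apply_single]
  rw [this, ← LinearMap.image_convexHull, convexHull_rangle_single_eq_stdSimplex]
  simp [stdSimplex, and_assoc]

lemma ehrhartCount_eq_ncard_latticeWeights {d : ℕ} {v : Fin (d + 1) → Fin d → ℝ}
    (hv : AffineIndependent ℝ v) (n : ℕ) :
    ehrhartCount (convexHull ℝ (Set.range v)) n = (latticeWeights v n).ncard := by
  have hinj : Set.InjOn (Fintype.linearCombination ℝ v) (latticeWeights v n) :=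
    fun a ha b hb hab => hv.eq_of_linearCombination_eq (ha.2.1.trans hb.2.1.symm) hab
  rw [← hinj.ncard_image]
  refine congrArg Set.ncard (Set.ext fun x => ⟨?_, ?_⟩)
  · rintro ⟨hx, y, hy, rfl⟩
    obtain ⟨c, h0, h1, rfl⟩ := mem_convexHull_range_iff.1 hy
    refine ⟨(n : ℝ) • c, ⟨fun i => mul_nonneg n.cast_nonneg (h0 i), ?_, ?_⟩, by simp⟩
    · simp [← Finset.mul_sum, h1]
    · simpa using hx
  · rintro ⟨c, ⟨h0, hs, hl⟩, rfl⟩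
    refine ⟨hl, ?_⟩
    rcases n.eq_zero_or_pos with rfl | hn
    · have hc : c = 0 := by
        funext i
        have := (Finset.sum_eq_zero_iff_of_nonneg (fun i _ => h0 i)).1 (by simpa using hs)
        exact this i (Finset.mem_univ i)
      subst hc
      exact ⟨v 0, subset_convexHull ℝ _ ⟨0, rfl⟩, by simp⟩
    · have hn' : (n : ℝ) ≠ 0 := by positivity
      refine ⟨Fintype.linearCombination ℝ v ((n : ℝ)⁻¹ • c), mem_convexHull_range_iff.2
        ⟨_, fun i => mul_nonneg (by positivity) (h0 i), ?_, rfl⟩, ?_⟩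
      · simp [← Finset.mul_sum, hs, hn']
      · simp [smul_smul, hn']

lemma coeff_mk_one_pow_eq_card (m n : ℕ) :
    PowerSeries.coeff n ((PowerSeries.mk 1 : PowerSeries ℤ) ^ m) =
      (Finset.finsuppAntidiag (Finset.univ : Finset (Fin m)) n).card := by
  have h := PowerSeries.coeff_prod (fun _ : Fin m => (PowerSeries.mk 1 : PowerSeries ℤ)) n
    Finset.univ
  simpa using h

lemma natFloor_sum_of_mem_simplexLambda {d : ℕ} {v : Fin (d + 1) → Fin d → ℝ}
    {c : Fin (d + 1) → ℝ} (hc : c ∈ simplexLambda v) : ((⌊∑ i, c i⌋₊ : ℕ) : ℝ) = ∑ i, c i := by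
  obtain ⟨z, hz⟩ := hc.2.2
  have h0 : (0 : ℝ) ≤ ∑ i, c i := Finset.sum_nonneg fun i _ => (hc.1 i).1
  rw [hz] at h0 ⊢
  lift z to ℕ using by exact_mod_cast h0
  simp

/-- The lattice points of the cone over a simplex, fibred over the half-open parallelepiped. -/
lemma card_fiber_fract_latticeWeights {d : ℕ} {v : Fin (d + 1) → Fin d → ℝ}
    (hv : AffineIndependent ℝ v) (hl : ∀ i, v i ∈ latticePts d) (n : ℕ) {c : Fin (d + 1) → ℝ}
    (hc : c ∈ simplexLambda v) :
    ((finite_latticeWeights hv n).toFinset.filter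
        fun x : Fin (d + 1) → ℝ => (fun i => Int.fract (x i)) = c).card =
      if ⌊∑ i, c i⌋₊ ≤ n then
        (Finset.finsuppAntidiag (Finset.univ : Finset (Fin (d + 1))) (n - ⌊∑ i, c i⌋₊)).card
      else 0 := by
  have hht := natFloor_sum_of_mem_simplexLambda hc
  have hsplit : ∀ x ∈ latticeWeights v n, (fun i => Int.fract (x i)) = c →
      ∀ i, x i = c i + (⌊x i⌋₊ : ℝ) := by
    rintro x hx rfl i
    rw [natCast_floor_eq_intCast_floor (hx.1 i)]
    exact (Int.fract_add_floor (x i)).symm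
  have hsum : ∀ x ∈ latticeWeights v n, (fun i => Int.fract (x i)) = c →
      ⌊∑ i, c i⌋₊ + ∑ i, ⌊x i⌋₊ = n := by
    intro x hx hxc
    have : (∑ i, x i : ℝ) = ∑ i, c i + ∑ i, (⌊x i⌋₊ : ℝ) := by
      rw [← Finset.sum_add_distrib]
      exact Finset.sum_congr rfl fun i _ => hsplit x hx hxc i
    rw [hx.2.1, ← hht] at this
    exact_mod_cast this.symm
  split_ifs with hn
  · refine Finset.card_bij' (fun x _ => Finsupp.equivFunOnFinite.symm fun i => ⌊x i⌋₊)
      (fun l _ i => c i + l i) ?_ ?_ ?_ ?_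
    · intro x hx
      simp only [Finset.mem_filter, Set.Finite.mem_toFinset] at hx
      have := hsum x hx.1 hx.2
      simp only [Finset.mem_finsuppAntidiag, Finsupp.equivFunOnFinite_symm_apply_apply,
        Finset.subset_univ, and_true]
      omega
    · intro l hlm
      simp only [Finset.mem_finsuppAntidiag, Finset.subset_univ, and_true] at hlm
      simp only [Finset.mem_filter, Set.Finite.mem_toFinset]
      refine ⟨⟨fun i => add_nonneg (hc.1 i).1 (Nat.cast_nonneg _), ?_, ?_⟩, ?_⟩
      · rw [Finset.sum_add_distrib, ← hht, ← Nat.cast_sum, hlm]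
        push_cast [hn]
        ring
      · have : (fun i => c i + (l i : ℝ)) = c + fun i => (((l i : ℕ) : ℤ) : ℝ) := by
          funext i
          simp
        rw [this, map_add]
        exact add_mem (mem_latticeSubgroup.2 (mem_simplexLambda_iff.1 hc).2.1)
          (linearCombination_intCast_mem hl _)
      · funext i
        rw [Int.fract_add_natCast, Int.fract_eq_self.2 (hc.1 i)]
    · intro x hx
      simp only [Finset.mem_filter, Set.Finite.mem_toFinset] at hx
      funext i
      simpa using (hsplit x hx.1 hx.2 i).symm
    · intro l _
      ext i
      simp only [Finsupp.equivFunOnFinite_symm_apply_apply]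
      rw [Nat.floor_add_natCast (hc.1 i).1, Nat.floor_eq_zero.2 (hc.1 i).2, zero_add]
  · rw [Finset.card_eq_zero, Finset.filter_eq_empty_iff]
    intro x hx hxc
    have := hsum x ((Set.Finite.mem_toFinset _).1 hx) hxc
    omega

/-- The `δ`-polynomial of a lattice simplex counts the points of its half-open parallelepiped by
height. -/
lemma hasDeltaPoly_sum_simplexLambda {d : ℕ} {v : Fin (d + 1) → Fin d → ℝ}
    (hv : AffineIndependent ℝ v) (hl : ∀ i, v i ∈ latticePts d) :
    HasDeltaPoly (convexHull ℝ (Set.range v))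
      (∑ c ∈ (finite_simplexLambda hv).toFinset, X ^ ⌊∑ i, c i⌋₊) := by
  have hseries : ehrhartSeries (convexHull ℝ (Set.range v)) =
      (∑ c ∈ (finite_simplexLambda hv).toFinset, PowerSeries.X ^ ⌊∑ i, c i⌋₊) *
        (PowerSeries.mk 1) ^ (d + 1) := by
    ext n
    rw [Finset.sum_mul, map_sum]
    simp only [PowerSeries.coeff_X_pow_mul', coeff_mk_one_pow_eq_card]
    have hcount : (ehrhartCount (convexHull ℝ (Set.range v)) n : ℤ) =
        ∑ c ∈ (finite_simplexLambda hv).toFinset, if ⌊∑ i, c i⌋₊ ≤ n then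
          ((Finset.finsuppAntidiag (Finset.univ : Finset (Fin (d + 1)))
            (n - ⌊∑ i, c i⌋₊)).card : ℤ) else 0 := by
      rw [ehrhartCount_eq_ncard_latticeWeights hv,
        Set.ncard_eq_toFinset_card _ (finite_latticeWeights hv n),
        Finset.card_eq_sum_card_fiberwise (f := fun x i => Int.fract (x i))
          (t := (finite_simplexLambda hv).toFinset), Nat.cast_sum]
      · refine Finset.sum_congr rfl fun c hc => ?_
        rw [card_fiber_fract_latticeWeights hv hl n ((Set.Finite.mem_toFinset _).1 hc)]
        push_cast
        rfl
      · intro x hx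
        have hx' := (Set.Finite.mem_toFinset _).1 hx
        exact (Set.Finite.mem_toFinset _).2
          (fract_mem_simplexLambda hl hx'.2.2 ⟨n, by simpa using hx'.2.1⟩)
    rw [← hcount, ehrhartSeries, PowerSeries.coeff_mk]
    split_ifs with hn
    · subst hn
      have : latticeWeights v 0 = {0} := by
        ext c
        refine ⟨fun hc => funext fun i => ?_, ?_⟩
        · exact (Finset.sum_eq_zero_iff_of_nonneg fun i _ => hc.1 i).1 (by simpa using hc.2.1) i
            (Finset.mem_univ i)
        · rintro rfl
          exact ⟨fun _ => le_rfl, by simp, by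
      rw [map_zero]
      exact zero_mem (latticeSubgroup d)⟩
      rw [ehrhartCount_eq_ncard_latticeWeights hv, this]
      simp
    · rfl
  rw [HasDeltaPoly, hseries, mul_comm, mul_assoc, ← mul_pow,
    PowerSeries.mk_one_mul_one_sub_eq_one, one_pow, mul_one]
  simp only [← Polynomial.coeToPowerSeries.ringHom_apply, map_sum, map_pow]
  simp

/-- If the half-open parallelepiped of a lattice simplex has exactly two points, then its nonzero
point has all coordinates `0` or `1/2`. -/
lemma exists_simplexLambda_eq_pair {d : ℕ} {v : Fin (d + 1) → Fin d → ℝ}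
    (hl : ∀ i, v i ∈ latticePts d) (h2 : (simplexLambda v).ncard = 2) :
    ∃ u : Fin (d + 1) → ℝ, u ≠ 0 ∧ (∀ i, u i = 0 ∨ u i = 1 / 2) ∧ simplexLambda v = {0, u} := by
  have h0 : (0 : Fin (d + 1) → ℝ) ∈ simplexLambda v :=
    mem_simplexLambda_iff.2 ⟨fun _ => by simp, by
      rw [map_zero]
      exact zero_mem (latticeSubgroup d),
      0, by simp⟩
  obtain ⟨a, b, hab, hE⟩ := Set.ncard_eq_two.1 h2
  obtain ⟨u, hu, hE⟩ : ∃ u : Fin (d + 1) → ℝ, u ≠ 0 ∧ simplexLambda v = {0, u} := by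
    rw [hE] at h0
    rcases h0 with rfl | h0
    · exact ⟨b, hab.symm, hE⟩
    · rw [Set.mem_singleton_iff] at h0
      subst h0
      exact ⟨a, hab, by rw [hE, Set.pair_comm]⟩
  have hmem : u ∈ simplexLambda v := by simp [hE]
  obtain ⟨hb, hlat, z, hz⟩ := mem_simplexLambda_iff.1 hmem
  have hdbl : (fun i => Int.fract ((u + u) i)) ∈ simplexLambda v := by
    refine fract_mem_simplexLambda hl ?_ ⟨z + z, ?_⟩
    · rw [map_add]
      exact add_mem (mem_latticeSubgroup.2 hlat) (mem_latticeSubgroup.2 hlat)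
    · simp [Finset.sum_add_distrib, hz]
  have hint : ∀ i, ∃ m : ℤ, u i + u i = m := by
    rw [hE] at hdbl
    rcases hdbl with h | h
    · intro i
      have := congrFun h i
      exact ⟨⌊u i + u i⌋, by have := Int.fract_add_floor (u i + u i); simp_all⟩
    · refine absurd (_root_.funext fun i => ?_) hu
      have h1 : Int.fract (u i + u i) = u i := congrFun h i
      have h3 : u i = (⌊u i + u i⌋ : ℝ) := by
        have := Int.fract_add_floor (u i + u i)
        linarith
      have hlt := (hb i).2
      have hge := (hb i).1
      rw [h3] at hlt hge
      have e : ⌊u i + u i⌋ = 0 :=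
        le_antisymm (Int.lt_add_one_iff.1 (by exact_mod_cast hlt)) (by exact_mod_cast hge)
      rw [h3, e]
      simp
  refine ⟨u, hu, fun i => ?_, hE⟩
  obtain ⟨m, hm⟩ := hint i
  have hlo : (-1 : ℝ) < m := by linarith [(hb i).1]
  have hhi : (m : ℝ) < 2 := by linarith [(hb i).2]
  have hlo' : -1 < m := by exact_mod_cast hlo
  have hhi' : m < 2 := by exact_mod_cast hhi
  obtain rfl | rfl : m = 0 ∨ m = 1 := by omega
  · left
    push_cast at hm
    linarith
  · right
    push_cast at hm
    linarith

/-- If the half-open parallelepiped is `{0, u}`, an affine combination of the vertices is integral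
exactly when its coefficients are an integer multiple of `u` modulo `1`. -/
lemma mem_latticePts_iff_of_simplexLambda_eq_pair {d : ℕ} {v : Fin (d + 1) → Fin d → ℝ}
    (hl : ∀ i, v i ∈ latticePts d) {u : Fin (d + 1) → ℝ} (hE : simplexLambda v = {0, u})
    {c : Fin (d + 1) → ℝ} (hc : ∑ i, c i = 1) :
    Fintype.linearCombination ℝ v c ∈ latticePts d ↔
      ∃ s : ℤ, ∀ i, ∃ z : ℤ, c i = s * u i + z := by
  constructor
  · intro h
    have hfr := fract_mem_simplexLambda hl h ⟨1, by simpa using hc⟩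
    rw [hE] at hfr
    rcases hfr with h | h
    · refine ⟨0, fun i => ⟨⌊c i⌋, ?_⟩⟩
      have h1 : Int.fract (c i) = 0 := congrFun h i
      have := Int.fract_add_floor (c i)
      push_cast
      linarith
    · refine ⟨1, fun i => ⟨⌊c i⌋, ?_⟩⟩
      have h1 : Int.fract (c i) = u i := congrFun h i
      have := Int.fract_add_floor (c i)
      push_cast
      linarith
  · rintro ⟨s, h⟩
    choose z hz using h
    have hu : u ∈ simplexLambda v := by simp [hE]
    have : c = s • u + fun i => (z i : ℝ) := by
      funext i
      simp [hz i]
    rw [this, map_add, map_zsmul]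
    exact add_mem (zsmul_mem (mem_latticeSubgroup.2 (mem_simplexLambda_iff.1 hu).2.1) s)
      (linearCombination_intCast_mem hl z)

/-- Vertices of a model simplex of normalized volume two: the origin, the standard basis vectors
other than the one of index `b`, and `∑ 2 u_{j+1} e_j + 2 e_b`. -/
def modelVertex {d : ℕ} (u : Fin (d + 1) → ℝ) (b : Fin d) : Fin (d + 1) → Fin d → ℝ :=
  Fin.cons 0 fun j i =>
    if j = b then (if i = b then 2 else 2 * u i.succ) else if i = j then 1 else 0

lemma linearCombination_modelVertex_apply {d : ℕ} (u : Fin (d + 1) → ℝ) (b : Fin d)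
    (c : Fin (d + 1) → ℝ) (i : Fin d) :
    Fintype.linearCombination ℝ (modelVertex u b) c i =
      if i = b then 2 * c b.succ else c i.succ + 2 * u i.succ * c b.succ := by
  simp only [Fintype.linearCombination_apply, Fin.sum_univ_succ, modelVertex, Fin.cons_zero,
    Fin.cons_succ, Finset.sum_apply, Pi.smul_apply, smul_eq_mul]
  rw [← Finset.add_sum_erase _ _ (Finset.mem_univ b)]
  have : ∑ x ∈ Finset.univ.erase b, c x.succ *
      (if x = b then (if i = b then 2 else 2 * u i.succ) else if i = x then 1 else 0) =
      ∑ x ∈ Finset.univ.erase b, if i = x then c x.succ else 0 :=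
    Finset.sum_congr rfl fun x hx => by simp [Finset.ne_of_mem_erase hx]
  rw [this, Finset.sum_ite_eq]
  by_cases h : i = b
  · simp [h, mul_comm]
  · simp [h]
    ring

lemma affineIndependent_modelVertex {d : ℕ} (u : Fin (d + 1) → ℝ) (b : Fin d) :
    AffineIndependent ℝ (modelVertex u b) := by
  rw [affineIndependent_iff_of_fintype]
  intro c hs h
  rw [Finset.univ.weightedVSub_eq_linear_combination hs, ← Fintype.linearCombination_apply] at h
  have hb : c b.succ = 0 := by
    have := congrFun h b
    rw [linearCombination_modelVertex_apply, if_pos rfl] at this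
    simpa using this
  have hsucc : ∀ i : Fin d, c i.succ = 0 := by
    intro i
    by_cases hi : i = b
    · rw [hi, hb]
    · have := congrFun h i
      rw [linearCombination_modelVertex_apply, if_neg hi, hb] at this
      simpa using this
  rw [Fin.sum_univ_succ, Finset.sum_eq_zero fun i _ => hsucc i, add_zero] at hs
  intro i
  refine Fin.cases hs hsucc i

lemma modelVertex_mem_latticePts_iff {d : ℕ} {u : Fin (d + 1) → ℝ} {b : Fin d}
    (h0 : u 0 = 1 / 2) (hb : u b.succ = 1 / 2) (hu : ∀ i, ∃ z : ℤ, 2 * u i = z)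
    (hsu : ∃ z : ℤ, ∑ i, u i = z) {c : Fin (d + 1) → ℝ} (hc : ∑ i, c i = 1) :
    Fintype.linearCombination ℝ (modelVertex u b) c ∈ latticePts d ↔
      ∃ s : ℤ, ∀ i, ∃ z : ℤ, c i = s * u i + z := by
  choose t ht using hu
  constructor
  · intro h
    choose n hn using h
    simp only [linearCombination_modelVertex_apply] at hn
    have hnb := hn b
    rw [if_pos rfl] at hnb
    have hsucc : ∀ i : Fin d, ∃ z : ℤ, c i.succ = n b * u i.succ + z := by
      intro i
      by_cases hi : i = b
      · subst hi
        exact ⟨0, by rw [hb]; push_cast; linarith⟩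
      · have := hn i
        rw [if_neg hi] at this
        refine ⟨n i - t i.succ * n b, ?_⟩
        push_cast
        rw [← ht]
        linear_combination this - u i.succ * hnb
    choose z hz using hsucc
    obtain ⟨m, hm⟩ := hsu
    refine ⟨n b, Fin.cases ⟨1 - n b * m - ∑ i, z i, ?_⟩ fun i => ⟨z i, hz i⟩⟩
    rw [Fin.sum_univ_succ, h0] at hm
    rw [Fin.sum_univ_succ, Finset.sum_congr rfl fun i _ => hz i, Finset.sum_add_distrib,
      ← Finset.mul_sum] at hc
    push_cast
    rw [h0]
    linear_combination hc - n b * hm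
  · rintro ⟨s, h⟩ i
    choose z hz using h
    rw [linearCombination_modelVertex_apply]
    split_ifs with hi
    · exact ⟨s + 2 * z b.succ, by rw [hz, hb]; push_cast; ring⟩
    · refine ⟨s * t i.succ + z i.succ + t i.succ * z b.succ, ?_⟩
      rw [hz i.succ, hz b.succ, hb]
      push_cast
      rw [← ht]
      ring

lemma unimodEquiv_modelVertex {d : ℕ} {v : Fin (d + 1) → Fin d → ℝ} (hv : AffineIndependent ℝ v)
    (hl : ∀ i, v i ∈ latticePts d) {u : Fin (d + 1) → ℝ} (hE : simplexLambda v = {0, u})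
    (hu : ∀ i, u i = 0 ∨ u i = 1 / 2) {b : Fin d} (h0 : u 0 = 1 / 2) (hb : u b.succ = 1 / 2) :
    UnimodEquiv (convexHull ℝ (Set.range v)) (convexHull ℝ (Set.range (modelVertex u b))) := by
  refine unimodEquiv_of_mem_latticePts_iff hv (affineIndependent_modelVertex u b) fun c hc => ?_
  rw [mem_latticePts_iff_of_simplexLambda_eq_pair hl hE hc,
    modelVertex_mem_latticePts_iff h0 hb ?_ ?_ hc]
  · intro i
    rcases hu i with h | h
    · exact ⟨0, by simp [h]⟩
    · exact ⟨1, by simp [h]⟩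
  · have : u ∈ simplexLambda v := by simp [hE]
    exact this.2.2

lemma modelVertex_mem_latticePts {d : ℕ} {u : Fin (d + 1) → ℝ} (b : Fin d)
    (hu : ∀ i, u i = 0 ∨ u i = 1 / 2) (i : Fin (d + 1)) : modelVertex u b i ∈ latticePts d := by
  intro j
  refine Fin.cases ⟨0, by simp [modelVertex]⟩ (fun i => ?_) i
  simp only [modelVertex, Fin.cons_succ]
  split_ifs
  · exact ⟨2, by simp⟩
  · rcases hu j.succ with h | h
    · exact ⟨0, by simp [h]⟩
    · exact ⟨1, by simp [h]⟩
  · exact ⟨1, by simp⟩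
  · exact ⟨0, by simp⟩

/-- The embedding `x ↦ (x, 0)` of `ℝ^m` into `ℝ^(m+1)`. -/
def snocZero (m : ℕ) : (Fin m → ℝ) →ₗ[ℝ] (Fin (m + 1) → ℝ) where
  toFun x := Fin.snoc x (0 : ℝ)
  map_add' x y := by
    funext i
    refine Fin.lastCases ?_ (fun i => ?_) i <;> simp
  map_smul' r x := by
    funext i
    refine Fin.lastCases ?_ (fun i => ?_) i <;> simp

/-- A simplex in `ℝ^(m+1)` with last vertex `e_{m+1}` and all others in the hyperplane
`x_{m+1} = 0` is a lattice pyramid. -/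
lemma exists_convexHull_eq_pyramidOver {m : ℕ} {w : Fin (m + 2) → Fin (m + 1) → ℝ}
    (hw : AffineIndependent ℝ w) (hl : ∀ i, w i ∈ latticePts (m + 1))
    (hlast : w (Fin.last (m + 1)) = Fin.snoc (0 : Fin m → ℝ) (1 : ℝ))
    (hbase : ∀ i : Fin (m + 1), w i.castSucc (Fin.last m) = 0) :
    ∃ Q : Set (Fin m → ℝ), IsLatticePolytope Q ∧ affineSpan ℝ Q = ⊤ ∧
      convexHull ℝ (Set.range w) = pyramidOver Q := by
  let q : Fin (m + 1) → Fin m → ℝ := fun i j => w i.castSucc j.castSucc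
  have hq : (snocZero m).toAffineMap ∘ q = w ∘ Fin.castSucc := by
    funext i j
    refine Fin.lastCases ?_ (fun j => ?_) j <;> simp [snocZero, q, hbase]
  have hqi : AffineIndependent ℝ q := by
    refine AffineIndependent.of_comp (snocZero m).toAffineMap ?_
    rw [hq]
    exact hw.comp_embedding ⟨Fin.castSucc, Fin.castSucc_injective _⟩
  refine ⟨convexHull ℝ (Set.range q), ⟨(Set.finite_range q).toFinset, ?_, by simp⟩, ?_, ?_⟩
  · rw [Set.Finite.coe_toFinset]
    rintro _ ⟨i, rfl⟩ j
    exact hl _ _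
  · rw [affineSpan_convexHull, hqi.affineSpan_range_eq_top]
  · have himg : (fun x : Fin m → ℝ => (Fin.snoc x (0 : ℝ) : Fin (m + 1) → ℝ)) ''
        convexHull ℝ (Set.range q) = convexHull ℝ (Set.range (w ∘ Fin.castSucc)) := by
      rw [← hq, Set.range_comp, ← AffineMap.image_convexHull]
      rfl
    have hr : Set.range w =
        Set.range (w ∘ Fin.castSucc) ∪ {Fin.snoc (0 : Fin m → ℝ) (1 : ℝ)} := by
      rw [← hlast]
      ext x
      simp [Fin.exists_fin_succ', eq_comm, or_comm]
    rw [pyramidOver, himg, convexHull_convexHull_union_left, hr]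

lemma isLatticePyramid_of_last_eq_zero {d : ℕ} {v : Fin (d + 1) → Fin d → ℝ}
    (hv : AffineIndependent ℝ v) (hl : ∀ i, v i ∈ latticePts d) {u : Fin (d + 1) → ℝ}
    (hE : simplexLambda v = {0, u}) (hu : ∀ i, u i = 0 ∨ u i = 1 / 2) (h0 : u 0 = 1 / 2)
    (hlast : u (Fin.last d) = 0) : IsLatticePyramid (convexHull ℝ (Set.range v)) := by
  obtain ⟨b, hb⟩ : ∃ b : Fin d, u b.succ = 1 / 2 := by
    by_contra! hne
    have huE : u ∈ simplexLambda v := by simp [hE]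
    obtain ⟨z, hz⟩ := huE.2.2
    rw [Fin.sum_univ_succ, h0,
      Finset.sum_eq_zero fun i _ => (hu (Fin.succ i)).resolve_right (hne i)] at hz
    have : (2 * z : ℤ) = 1 := by
      have : (2 * z : ℝ) = 1 := by linarith
      exact_mod_cast this
    omega
  cases d with
  | zero => exact b.elim0
  | succ m =>
    have hbm : Fin.last m ≠ b := by
      rintro rfl
      rw [Fin.succ_last, hlast] at hb
      norm_num at hb
    obtain ⟨Q, hQ, hspan, hpyr⟩ := exists_convexHull_eq_pyramidOver
      (affineIndependent_modelVertex u b) (modelVertex_mem_latticePts b hu) (by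
        rw [← Fin.succ_last]
        funext i
        simp only [modelVertex, Fin.cons_succ, if_neg hbm]
        refine Fin.lastCases ?_ (fun i => ?_) i
        · simp
        · simp [(Fin.castSucc_lt_last i).ne]) (by
        intro i
        refine Fin.cases (by simp [modelVertex]) (fun i => ?_) i
        rw [← Fin.succ_castSucc]
        simp only [modelVertex, Fin.cons_succ, if_neg hbm, Fin.succ_last, hlast, mul_zero,
          if_neg (Fin.castSucc_lt_last i).ne', ite_self])
    exact ⟨m, Q, hQ, hspan, hpyr ▸ unimodEquiv_modelVertex hv hl hE hu h0 hb⟩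

lemma simplexLambda_comp_perm {d : ℕ} {v : Fin (d + 1) → Fin d → ℝ} {u : Fin (d + 1) → ℝ}
    (hE : simplexLambda v = {0, u}) (σ : Equiv.Perm (Fin (d + 1))) :
    simplexLambda (v ∘ σ) = {0, u ∘ σ} := by
  have hcomp : ∀ c : Fin (d + 1) → ℝ, c ∘ σ ∈ simplexLambda (v ∘ σ) ↔ c ∈ simplexLambda v := by
    intro c
    rw [mem_simplexLambda_iff, mem_simplexLambda_iff]
    simp only [Fintype.linearCombination_apply, Function.comp_apply]
    rw [Equiv.sum_comp σ (fun i => c i • v i), Equiv.sum_comp σ c,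
      σ.forall_congr_right (q := fun i => 0 ≤ c i ∧ c i < 1)]
  ext c
  have hc : c = (c ∘ σ.symm) ∘ σ := by
    funext i
    simp
  have hinj : ∀ a b : Fin (d + 1) → ℝ, a ∘ σ = b ∘ σ ↔ a = b := fun a b =>
    σ.surjective.injective_comp_right.eq_iff
  have hz : (0 : Fin (d + 1) → ℝ) = (0 : Fin (d + 1) → ℝ) ∘ σ := rfl
  rw [hc, hcomp, hE, Set.mem_insert_iff, Set.mem_insert_iff, Set.mem_singleton_iff,
    Set.mem_singleton_iff, hinj]
  conv_rhs => rw [hz, hinj]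

lemma isLatticePyramid_of_apply_eq_zero {d : ℕ} {v : Fin (d + 1) → Fin d → ℝ}
    (hv : AffineIndependent ℝ v) (hl : ∀ i, v i ∈ latticePts d) {u : Fin (d + 1) → ℝ}
    (hE : simplexLambda v = {0, u}) (hu : ∀ i, u i = 0 ∨ u i = 1 / 2) (hne : u ≠ 0)
    {j : Fin (d + 1)} (hj : u j = 0) : IsLatticePyramid (convexHull ℝ (Set.range v)) := by
  obtain ⟨a, ha⟩ := Function.ne_iff.1 hne
  have ha' := (hu a).resolve_left ha
  have haj : a ≠ j := by
    rintro rfl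
    exact ha hj
  have hlast : Fin.last d ≠ 0 := by
    intro h
    obtain rfl := Fin.last_eq_zero_iff.1 h
    exact haj (Subsingleton.elim (α := Fin 1) a j)
  let τ : Equiv.Perm (Fin (d + 1)) := Equiv.swap 0 a
  let σ : Equiv.Perm (Fin (d + 1)) := (Equiv.swap (Fin.last d) (τ j)).trans τ
  have hτj : τ j ≠ 0 := by
    intro h
    exact haj (τ.injective (by simp [τ, h] : τ j = τ a)).symm
  have hσ0 : σ 0 = a := by
    simp [σ, Equiv.swap_apply_of_ne_of_ne hlast.symm hτj.symm, τ]
  have hσl : σ (Fin.last d) = j := by simp [σ, τ]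
  have := isLatticePyramid_of_last_eq_zero (v := v ∘ σ) (hv.comp_embedding σ.toEmbedding)
    (fun i => hl _) (simplexLambda_comp_perm hE σ) (fun i => hu _)
    (by simp [hσ0, ha']) (by simp [hσl, hj])
  rwa [σ.surjective.range_comp] at this

lemma convexHull_range_modelVertex_half_last {m : ℕ} :
    convexHull ℝ (Set.range (modelVertex (fun _ => (1 / 2 : ℝ)) (Fin.last m))) =
      deltaTwoSimplex (m + 1) := by
  refine congrArg _ (Set.ext fun x => ?_)
  constructor
  · rintro ⟨i, rfl⟩
    refine Fin.cases (Or.inl (Or.inl rfl)) (fun i => ?_) i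
    refine Fin.lastCases (Or.inl (Or.inr ?_)) (fun i => Or.inr ⟨i.castSucc, by simp, ?_⟩) i
    · funext j
      simp [modelVertex, Fin.ext_iff]
    · funext j
      simp [modelVertex, stdE, (Fin.castSucc_lt_last i).ne]
  · rintro ((rfl | rfl) | ⟨j, hj, rfl⟩)
    · exact ⟨0, rfl⟩
    · refine ⟨(Fin.last m).succ, funext fun j => ?_⟩
      simp [modelVertex, Fin.ext_iff]
    · have hj' : j ≠ Fin.last m := by
        rintro rfl
        simp at hj
      exact ⟨j.succ, funext fun i => by simp [modelVertex, stdE, hj']⟩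

/-- classification of lattice simplices of normalized volume 2 which are
not lattice pyramids. -/
theorem simplex_volume_two_classification {d : ℕ} (Δ : Set (Fin d → ℝ))
    (hΔ : IsLatticeSimplexFD Δ)
    (hvol : ∃ p : Polynomial ℤ, HasDeltaPoly Δ p ∧ p.eval 1 = 2)
    (hpyr : ¬ IsLatticePyramid Δ) :
    ∃ k : ℕ, 1 ≤ k ∧ d = 2 * k - 1 ∧ HasDeltaPoly Δ (1 + X ^ k) ∧
      UnimodEquiv Δ (deltaTwoSimplex d) := by
  obtain ⟨v, hv, hl, rfl⟩ := hΔ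
  obtain ⟨p, hp, hp2⟩ := hvol
  have hδ := hasDeltaPoly_sum_simplexLambda hv hl
  have hcard : (simplexLambda v).ncard = 2 := by
    have hpe : p = ∑ c ∈ (finite_simplexLambda hv).toFinset, X ^ ⌊∑ i, c i⌋₊ :=
      Polynomial.coe_injective ℤ (hp.symm.trans hδ)
    rw [hpe, Polynomial.eval_finsetSum] at hp2
    rw [Set.ncard_eq_toFinset_card _ (finite_simplexLambda hv)]
    simp only [eval_pow, eval_X, one_pow, Finset.sum_const, nsmul_eq_mul, mul_one] at hp2
    exact_mod_cast hp2
  obtain ⟨u, hne, hu, hE⟩ := exists_simplexLambda_eq_pair hl hcard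
  have hhalf : u = fun _ => 1 / 2 := funext fun i => (hu i).resolve_left fun hi =>
    hpyr (isLatticePyramid_of_apply_eq_zero hv hl hE hu hne hi)
  subst hhalf
  have hmem : (fun _ => 1 / 2) ∈ simplexLambda v := by simp [hE]
  have hk := natFloor_sum_of_mem_simplexLambda hmem
  rw [show (finite_simplexLambda hv).toFinset = {0, fun _ => 1 / 2} by
    ext; simp [hE], Finset.sum_pair hne.symm] at hδ
  generalize ⌊∑ _i : Fin (d + 1), (1 / 2 : ℝ)⌋₊ = k at hk hδ
  have hk2 : 2 * k = d + 1 := by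
    have : (2 * k : ℝ) = d + 1 := by
      rw [hk]
      simp
      ring
    exact_mod_cast this
  obtain ⟨m, rfl⟩ : ∃ m, d = m + 1 := ⟨d - 1, by omega⟩
  refine ⟨k, by omega, by omega, by simpa using hδ, ?_⟩
  rw [← convexHull_range_modelVertex_half_last]
  exact unimodEquiv_modelVertex hv hl hE hu rfl rfl
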